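/- arXiv:2503.09544 — 2 statements merged into one kernel-verified Lean document; each statement's English description precedes it below -/
import Mathlib

section
/- Let n, m ∈ ℕ and let f : {0,1}^n × {0,1}^n → {0,1}^m reproduce the uniform distribution over {0,1}^m. Then for all e_A, e_B ∈ ℕ, every unit vector ψ ∈ V ⊗ A' ⊗ B', and every family of unitaries K^{xy} on A' and L^{xy} on B' indexed by (x,y) ∈ {0,1}^n × {0,1}^n, one has 2^{−2n} · Σ_{x,y∈{0,1}^n} ⟨Ψ_{xy}, N^{f(x,y)}_{0^m} Ψ_{xy}⟩ ≤ (1/2 + 1/(2√2))^m, where Ψ_{xy} := (I_V ⊗ K^{xy} ⊗ L^{xy})ψ and 0^m is the all-zeros string. -/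
open Matrix Kronecker Finset
open scoped ComplexOrder

noncomputable section

/-- Bit strings of length `n`. -/
abbrev Bits (n : ℕ) := Fin n → Bool

/-- Binary entropy function `h(p) = -p log₂ p - (1-p) log₂ (1-p)` (with `h 0 = 0`). -/
def binEnt (p : ℝ) : ℝ := -(p * Real.logb 2 p) - (1 - p) * Real.logb 2 (1 - p)

/-- `μ_γ = 2^{γ+h(γ)} (1/2 + 1/(2√2))`. -/
def muGamma (γ : ℝ) : ℝ := (2 : ℝ) ^ (γ + binEnt γ) * (1 / 2 + 1 / (2 * Real.sqrt 2))

/-- The EPR pair `Φ⁺ = (|00⟩+|11⟩)/√2 ∈ ℂ² ⊗ ℂ²`. -/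
def phiPlus : Bool × Bool → ℂ := fun p => if p.1 = p.2 then (1 / (Real.sqrt 2 : ℂ)) else 0

/-- The rank-one projector `|Φ⁺⟩⟨Φ⁺|`. -/
def projPhiPlus : Matrix (Bool × Bool) (Bool × Bool) ℂ :=
  Matrix.vecMulVec phiPlus (star phiPlus)

/-- The two-qubit measurement operator: `|Φ⁺⟩⟨Φ⁺|` for outcome `a = 0`,
`I − |Φ⁺⟩⟨Φ⁺|` for outcome `a = 1`. -/
def Nbit (a : Bool) : Matrix (Bool × Bool) (Bool × Bool) ℂ :=
  if a then 1 - projPhiPlus else projPhiPlus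

/-- `N^z_a` on `V ⊗ A' ⊗ B'` with `V = (ℂ²)^{⊗m}`, `A' = (ℂ²)^{⊗m} ⊗ E_A`,
`B' = (ℂ²)^{⊗m} ⊗ E_B`: for each `i`, acts on the `i`-th qubit of `V` together with the
`i`-th output qubit of `A'` (if `z_i = 0`) or of `B'` (if `z_i = 1`) as `Nbit (a i)`,
and as the identity elsewhere. -/
def Nmat (m : ℕ) {EA EB : Type*} [DecidableEq EA] [DecidableEq EB] (z a : Bits m) :
    Matrix (Bits m × (Bits m × EA) × (Bits m × EB))
      (Bits m × (Bits m × EA) × (Bits m × EB)) ℂ :=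
  fun r c =>
    (if r.2.1.2 = c.2.1.2 then 1 else 0) * (if r.2.2.2 = c.2.2.2 then 1 else 0) *
      ∏ i : Fin m,
        (if z i then
          (if r.2.1.1 i = c.2.1.1 i then 1 else 0) *
            Nbit (a i) (r.1 i, r.2.2.1 i) (c.1 i, c.2.2.1 i)
        else
          (if r.2.2.1 i = c.2.2.1 i then 1 else 0) *
            Nbit (a i) (r.1 i, r.2.1.1 i) (c.1 i, c.2.1.1 i))

/-- Hamming weight of a bit string. -/
def hw {m : ℕ} (a : Bits m) : ℕ := (Finset.univ.filter (fun i => a i = true)).card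

/-- The state `Ψ_{xy} = (I_V ⊗ K^{xy} ⊗ L^{xy})ψ`. -/
def routPsi (n m eA eB : ℕ)
    (ψ : Bits m × (Bits m × Fin eA) × (Bits m × Fin eB) → ℂ)
    (K : Bits n → Bits n → Matrix (Bits m × Fin eA) (Bits m × Fin eA) ℂ)
    (L : Bits n → Bits n → Matrix (Bits m × Fin eB) (Bits m × Fin eB) ℂ)
    (x y : Bits n) : Bits m × (Bits m × Fin eA) × (Bits m × Fin eB) → ℂ :=
  ((1 : Matrix (Bits m) (Bits m) ℂ) ⊗ₖ (K x y ⊗ₖ L x y)).mulVec ψ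

/-- A quadratic-form version of the bound on the norm of a sum of projections: vectors `v p` whose
pairwise overlaps are controlled by a symmetric kernel with bounded row sums have bounded total
overlap with a unit vector. -/
theorem sum_re_inner_le_of_overlap {ι E : Type*} [Fintype ι] [NormedAddCommGroup E]
    [InnerProductSpace ℂ E] (ψ : E) (hψ : ‖ψ‖ = 1) (v : ι → E) (c : ι → ι → ℝ) (C : ℝ)
    (hv : ∀ p, ‖v p‖ ^ 2 ≤ (inner ℂ ψ (v p)).re) (hc0 : ∀ p q, 0 ≤ c p q)
    (hsymm : ∀ p q, c p q = c q p) (hrow : ∀ p, ∑ q, c p q ≤ C)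
    (hov : ∀ p q, ‖inner ℂ (v p) (v q)‖ ≤ c p q * (‖v p‖ * ‖v q‖)) (hC : 0 ≤ C) :
    ∑ p, (inner ℂ ψ (v p)).re ≤ C := by
  set s := ∑ p, (inner ℂ ψ (v p)).re with hs
  have hs0 : 0 ≤ s := Finset.sum_nonneg fun p _ => (sq_nonneg _).trans (hv p)
  have hle : s ≤ ‖∑ p, v p‖ := by
    have : s = (inner ℂ ψ (∑ p, v p)).re := by rw [inner_sum, Complex.re_sum]
    rw [this]
    calc _ ≤ ‖inner ℂ ψ (∑ p, v p)‖ := Complex.re_le_norm _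
      _ ≤ ‖ψ‖ * ‖∑ p, v p‖ := norm_inner_le_norm _ _
      _ = _ := by rw [hψ, one_mul]
  have hsq : ‖∑ p, v p‖ ^ 2 ≤ C * s := by
    have hexp : ‖∑ p, v p‖ ^ 2 = ∑ p, ∑ q, (inner ℂ (v p) (v q)).re := by
      rw [← inner_self_eq_norm_sq (𝕜 := ℂ), sum_inner]
      simp only [inner_sum, RCLike.re_to_complex, Complex.re_sum]
    have hrowsum : ∑ p, ∑ q, c p q * ‖v p‖ ^ 2 ≤ C * s := by
      rw [hs, Finset.mul_sum]
      refine Finset.sum_le_sum fun p _ => ?_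
      rw [← Finset.sum_mul]
      exact mul_le_mul (hrow p) (hv p) (sq_nonneg _) hC
    have hcolsum : ∑ p, ∑ q, c p q * ‖v q‖ ^ 2 ≤ C * s := by
      rw [Finset.sum_comm]
      simpa only [hsymm] using hrowsum
    calc ‖∑ p, v p‖ ^ 2 = ∑ p, ∑ q, (inner ℂ (v p) (v q)).re := hexp
      _ ≤ ∑ p, ∑ q, (c p q * ‖v p‖ ^ 2 / 2 + c p q * ‖v q‖ ^ 2 / 2) := by
        refine Finset.sum_le_sum fun p _ => Finset.sum_le_sum fun q _ => ?_
        have h1 := (Complex.re_le_norm _).trans (hov p q)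
        nlinarith [mul_nonneg (hc0 p q) (sq_nonneg (‖v p‖ - ‖v q‖))]
      _ ≤ C * s := by
        simp only [Finset.sum_add_distrib, ← Finset.sum_div]
        linarith
  have : s * s ≤ C * s := by nlinarith [norm_nonneg (∑ p, v p)]
  rcases hs0.eq_or_lt with h | h
  · rw [← h]; exact hC
  · exact le_of_mul_le_mul_right this h

/-- Each involution `σ i` toggles the condition `P i`, so imposing the conditions indexed by `S`
on an invariant function divides its total mass by `2 ^ #S`. -/
theorem sum_ite_forall_eq_half_pow {J ι : Type*} [Fintype J] [DecidableEq ι] (S : Finset ι)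
    (σ : ι → J → J) (hσ : ∀ i, Function.Involutive (σ i)) (P : ι → J → Prop)
    [∀ i, DecidablePred (P i)] (htoggle : ∀ i r, P i (σ i r) ↔ ¬ P i r)
    (hkeep : ∀ i j r, i ≠ j → (P j (σ i r) ↔ P j r)) (F : J → ℝ)
    (hF : ∀ i ∈ S, ∀ r, F (σ i r) = F r) :
    ∑ r, (if ∀ i ∈ S, P i r then F r else 0) = (1 / 2) ^ S.card * ∑ r, F r := by
  induction S using Finset.induction_on with
  | empty => simp
  | insert i S hi ih =>
    rw [Finset.card_insert_of_notMem hi, pow_succ']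
    have ih' := ih fun j hj => hF j (Finset.mem_insert_of_mem hj)
    have hsplit : ∑ r, (if ∀ j ∈ S, P j r then F r else 0)
        = ∑ r, (if ∀ j ∈ insert i S, P j r then F r else 0)
          + ∑ r, (if (¬ P i r) ∧ ∀ j ∈ S, P j r then F r else 0) := by
      rw [← Finset.sum_add_distrib]
      refine Finset.sum_congr rfl fun r _ => ?_
      by_cases h1 : P i r <;> by_cases h2 : ∀ j ∈ S, P j r <;> simp [h1, h2]
    have hflip : ∑ r, (if (¬ P i r) ∧ ∀ j ∈ S, P j r then F r else 0)
        = ∑ r, (if ∀ j ∈ insert i S, P j r then F r else 0) := by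
      refine Fintype.sum_equiv (hσ i).toPerm _ _ fun r => ?_
      have hS : (∀ j ∈ S, P j (σ i r)) ↔ ∀ j ∈ S, P j r :=
        forall₂_congr fun j hj => hkeep i j r fun h => hi (h ▸ hj)
      simp only [Function.Involutive.coe_toPerm, Finset.forall_mem_insert, htoggle, hS,
        hF i (Finset.mem_insert_self i S)]
    rw [mul_assoc, ← ih']
    linarith

/-- If two vectors are invariant under involutions toggling the conditions `P i`, `i ∈ S`, and
their common support satisfies these conditions, then their overlap is at most `2 ^ (-#S)`. -/
theorem norm_inner_le_half_pow {J ι : Type*} [Fintype J] [DecidableEq ι] (S : Finset ι)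
    (σ τ : ι → J → J) (hσ : ∀ i, Function.Involutive (σ i)) (hτ : ∀ i, Function.Involutive (τ i))
    (P : ι → J → Prop) [∀ i, DecidablePred (P i)]
    (hσP : ∀ i r, P i (σ i r) ↔ ¬ P i r) (hσP' : ∀ i j r, i ≠ j → (P j (σ i r) ↔ P j r))
    (hτP : ∀ i r, P i (τ i r) ↔ ¬ P i r) (hτP' : ∀ i j r, i ≠ j → (P j (τ i r) ↔ P j r))
    (x y : J → ℂ) (hx : ∀ i ∈ S, ∀ r, x (σ i r) = x r) (hy : ∀ i ∈ S, ∀ r, y (τ i r) = y r)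
    (hxy : ∀ r, ∀ i ∈ S, ¬ P i r → x r = 0 ∨ y r = 0) :
    ‖inner ℂ (WithLp.toLp 2 x) (WithLp.toLp 2 y)‖
      ≤ (1 / 2) ^ S.card * (‖WithLp.toLp 2 x‖ * ‖WithLp.toLp 2 y‖) := by
  classical
  let res : (J → ℂ) → EuclideanSpace ℂ J := fun w =>
    WithLp.toLp 2 fun r => if ∀ i ∈ S, P i r then w r else 0
  have hnorm : ∀ (ρ : ι → J → J) (w : J → ℂ), (∀ i, Function.Involutive (ρ i)) →
      (∀ i r, P i (ρ i r) ↔ ¬ P i r) → (∀ i j r, i ≠ j → (P j (ρ i r) ↔ P j r)) →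
      (∀ i ∈ S, ∀ r, w (ρ i r) = w r) →
      ‖res w‖ ^ 2 = (1 / 2) ^ S.card * ‖WithLp.toLp 2 w‖ ^ 2 := by
    intro ρ w h1 h2 h3 h4
    rw [EuclideanSpace.norm_sq_eq, EuclideanSpace.norm_sq_eq,
      ← sum_ite_forall_eq_half_pow S ρ h1 P h2 h3 (fun r => ‖w r‖ ^ 2)
        (fun i hi r => by simp only [h4 i hi r])]
    refine Finset.sum_congr rfl fun r _ => ?_
    by_cases h : ∀ i ∈ S, P i r
    · simp only [res, if_pos h]
    · simp [res, if_neg h]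
  have hinner : inner ℂ (WithLp.toLp 2 x) (WithLp.toLp 2 y) = inner ℂ (res x) (res y) := by
    simp only [PiLp.inner_apply, res]
    refine Finset.sum_congr rfl fun r _ => ?_
    by_cases h : ∀ i ∈ S, P i r
    · simp only [if_pos h]
    · have h' := h
      push Not at h'
      obtain ⟨i, hi, hP⟩ := h'
      rcases hxy r i hi hP with h0 | h0 <;> simp [h, h0]
  rw [hinner]
  refine (norm_inner_le_norm _ _).trans ?_
  refine le_of_sq_le_sq ?_ (by positivity)
  rw [mul_pow, hnorm σ x hσ hσP hσP' hx, hnorm τ y hτ hτP hτP' hy]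
  exact le_of_eq (by ring)

theorem norm_toLp_mulVec_of_conjTranspose_mul_eq_one {J : Type*} [Fintype J] [DecidableEq J]
    (U : Matrix J J ℂ) (hU : Uᴴ * U = 1) (x : J → ℂ) :
    ‖WithLp.toLp 2 (U *ᵥ x)‖ = ‖WithLp.toLp 2 x‖ := by
  rw [← sq_eq_sq₀ (norm_nonneg _) (norm_nonneg _), ← Complex.ofReal_inj]
  push_cast
  have h : ∀ w : J → ℂ, ((‖WithLp.toLp 2 w‖ : ℂ)) ^ 2 = star w ⬝ᵥ w := fun w => by
    rw [dotProduct_comm, ← EuclideanSpace.inner_toLp_toLp, inner_self_eq_norm_sq_to_K]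
    rfl
  rw [h, h, star_mulVec, dotProduct_mulVec, vecMul_vecMul, ← dotProduct_mulVec, hU, one_mulVec]

theorem inner_toLp_mulVec_mulVec {J : Type*} [Fintype J] (A B : Matrix J J ℂ) (x y : J → ℂ) :
    inner ℂ (WithLp.toLp 2 (A *ᵥ x)) (WithLp.toLp 2 (B *ᵥ y)) = star x ⬝ᵥ (Aᴴ * B) *ᵥ y := by
  rw [EuclideanSpace.inner_toLp_toLp, dotProduct_comm, star_mulVec, ← mulVec_mulVec,
    ← dotProduct_mulVec]

theorem Nbit_false_apply (p q : Bool × Bool) :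
    Nbit false p q = if p.1 = p.2 ∧ q.1 = q.2 then 1 / 2 else 0 := by
  have h : ((Real.sqrt 2 : ℂ))⁻¹ * (Real.sqrt 2 : ℂ)⁻¹ = 1 / 2 := by
    rw [← mul_inv, ← Complex.ofReal_mul, Real.mul_self_sqrt (by norm_num)]
    norm_num
  by_cases hp : p.1 = p.2 <;> by_cases hq : q.1 = q.2 <;>
    simp [Nbit, projPhiPlus, vecMulVec_apply, phiPlus, hp, hq]
  simpa using h

/-- The factor of `N^z_0` acting on the `i`-th qubits of `V`, `A'` and `B'` when `z i = b`. -/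
def siteProj (b : Bool) : Matrix (Bool × Bool × Bool) (Bool × Bool × Bool) ℂ := fun r c =>
  if b then (if r.2.1 = c.2.1 then 1 else 0) * Nbit false (r.1, r.2.2) (c.1, c.2.2)
  else (if r.2.2 = c.2.2 then 1 else 0) * Nbit false (r.1, r.2.1) (c.1, c.2.1)

theorem siteProj_mul_self (b : Bool) : siteProj b * siteProj b = siteProj b := by
  ext ⟨r1, r2, r3⟩ ⟨c1, c2, c3⟩
  cases b <;> cases r1 <;> cases r2 <;> cases r3 <;> cases c1 <;> cases c2 <;> cases c3 <;>
    simp [siteProj, mul_apply, Fintype.sum_prod_type, Nbit_false_apply]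

theorem siteProj_conjTranspose (b : Bool) : (siteProj b)ᴴ = siteProj b := by
  ext ⟨r1, r2, r3⟩ ⟨c1, c2, c3⟩
  cases b <;> cases r1 <;> cases r2 <;> cases r3 <;> cases c1 <;> cases c2 <;> cases c3 <;>
    simp [siteProj, Nbit_false_apply]

section

variable {m : ℕ} {EA EB : Type*}

/-- The `i`-th qubits of `V`, `A'` and `B'`. -/
def site (r : Bits m × (Bits m × EA) × (Bits m × EB)) (i : Fin m) : Bool × Bool × Bool :=
  (r.1 i, r.2.1.1 i, r.2.2.1 i)

/-- Grouping the qubits of `V ⊗ A' ⊗ B'` by site. -/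
def siteEquiv (m : ℕ) (EA EB : Type*) :
    Bits m × (Bits m × EA) × (Bits m × EB) ≃ (Fin m → Bool × Bool × Bool) × EA × EB where
  toFun r := (site r, r.2.1.2, r.2.2.2)
  invFun s := (fun i => (s.1 i).1, (fun i => (s.1 i).2.1, s.2.1), (fun i => (s.1 i).2.2, s.2.2))
  left_inv _ := rfl
  right_inv _ := rfl

theorem Nmat_false_apply [DecidableEq EA] [DecidableEq EB]
    (z : Bits m) (r c : Bits m × (Bits m × EA) × (Bits m × EB)) :
    Nmat m z (fun _ => false) r c =
      (if r.2.1.2 = c.2.1.2 then 1 else 0) * (if r.2.2.2 = c.2.2.2 then 1 else 0) *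
        ∏ i, siteProj (z i) (site r i) (site c i) := rfl

theorem Nmat_false_conjTranspose [DecidableEq EA] [DecidableEq EB]
    (z : Bits m) :
    (Nmat m z (fun _ => false) : Matrix (Bits m × (Bits m × EA) × (Bits m × EB)) _ ℂ)ᴴ =
      Nmat m z (fun _ => false) := by
  ext r c
  rw [conjTranspose_apply, Nmat_false_apply, Nmat_false_apply, star_mul', star_mul', star_prod]
  congr 1
  · congr 1 <;> simp [apply_ite, eq_comm]
  · refine Finset.prod_congr rfl fun i _ => ?_
    rw [← conjTranspose_apply, siteProj_conjTranspose]

theorem Nmat_false_mul_self [DecidableEq EA] [DecidableEq EB] [Fintype EA] [Fintype EB]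
    (z : Bits m) :
    (Nmat m z (fun _ => false) : Matrix (Bits m × (Bits m × EA) × (Bits m × EB)) _ ℂ) *
      Nmat m z (fun _ => false) = Nmat m z (fun _ => false) := by
  ext r c
  rw [mul_apply, ← (siteEquiv m EA EB).symm.sum_comp, Fintype.sum_prod_type]
  simp only [Fintype.sum_prod_type (α₁ := EA), Nmat_false_apply]
  have hsite : ∀ s e e', site ((siteEquiv m EA EB).symm (s, e, e')) = s := fun _ _ _ => rfl
  have hA : ∀ s e e', ((siteEquiv m EA EB).symm (s, e, e')).2.1.2 = e := fun _ _ _ => rfl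
  have hB : ∀ s e e', ((siteEquiv m EA EB).symm (s, e, e')).2.2.2 = e' := fun _ _ _ => rfl
  have hprod : ∏ i, siteProj (z i) (site r i) (site c i) = ∑ s : Fin m → Bool × Bool × Bool,
      (∏ i, siteProj (z i) (site r i) (s i)) * ∏ i, siteProj (z i) (s i) (site c i) := by
    simp only [← Finset.prod_mul_distrib]
    rw [← Fintype.prod_sum fun i t =>
      siteProj (z i) (site r i) t * siteProj (z i) t (site c i)]
    refine Finset.prod_congr rfl fun i _ => ?_
    rw [← mul_apply, siteProj_mul_self]
  simp only [hsite, hA, hB, hprod, Finset.mul_sum]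
  refine Finset.sum_congr rfl fun s _ => ?_
  rw [Finset.sum_eq_single r.2.1.2, Finset.sum_eq_single r.2.2.2]
  · simp only [if_true]; ring
  · intro e _ he; simp [he.symm]
  · simp
  · intro e _ he; simp [he.symm]
  · simp

/-- Flipping the `i`-th bit. -/
def flipBit (i : Fin m) (v : Bits m) : Bits m := Function.update v i (!v i)

theorem flipBit_involutive (i : Fin m) : Function.Involutive (flipBit i) := fun v => by
  simp [flipBit]

theorem flipBit_apply_self (i : Fin m) (v : Bits m) : flipBit i v i = !v i := by
  simp [flipBit]

theorem flipBit_apply_of_ne {i j : Fin m} (h : i ≠ j) (v : Bits m) : flipBit i v j = v j := by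
  simp [flipBit, h.symm]

/-- Flipping the `i`-th qubits of `V` and of `A'`. -/
def flipA (i : Fin m) (r : Bits m × (Bits m × EA) × (Bits m × EB)) :
    Bits m × (Bits m × EA) × (Bits m × EB) :=
  (flipBit i r.1, (flipBit i r.2.1.1, r.2.1.2), r.2.2)

/-- Flipping the `i`-th qubits of `V` and of `B'`. -/
def flipB (i : Fin m) (r : Bits m × (Bits m × EA) × (Bits m × EB)) :
    Bits m × (Bits m × EA) × (Bits m × EB) :=
  (flipBit i r.1, r.2.1, (flipBit i r.2.2.1, r.2.2.2))

theorem siteProj_false_apply_not (v a b : Bool) (c : Bool × Bool × Bool) :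
    siteProj false (!v, !a, b) c = siteProj false (v, a, b) c := by
  simp [siteProj, Nbit_false_apply]

theorem siteProj_true_apply_not (v a b : Bool) (c : Bool × Bool × Bool) :
    siteProj true (!v, a, !b) c = siteProj true (v, a, b) c := by
  simp [siteProj, Nbit_false_apply]

theorem Nmat_false_flipA [DecidableEq EA] [DecidableEq EB]
    (z : Bits m) (i : Fin m) (hz : z i = false)
    (r c : Bits m × (Bits m × EA) × (Bits m × EB)) :
    Nmat m z (fun _ => false) (flipA i r) c = Nmat m z (fun _ => false) r c := by
  rw [Nmat_false_apply, Nmat_false_apply]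
  congr 1
  refine Finset.prod_congr rfl fun j _ => ?_
  rcases eq_or_ne i j with rfl | h
  · simp only [site, flipA, flipBit_apply_self, hz, siteProj_false_apply_not]
  · simp only [site, flipA, flipBit_apply_of_ne h]

theorem Nmat_false_flipB [DecidableEq EA] [DecidableEq EB]
    (z : Bits m) (i : Fin m) (hz : z i = true)
    (r c : Bits m × (Bits m × EA) × (Bits m × EB)) :
    Nmat m z (fun _ => false) (flipB i r) c = Nmat m z (fun _ => false) r c := by
  rw [Nmat_false_apply, Nmat_false_apply]
  congr 1
  refine Finset.prod_congr rfl fun j _ => ?_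
  rcases eq_or_ne i j with rfl | h
  · simp only [site, flipB, flipBit_apply_self, hz, siteProj_true_apply_not]
  · simp only [site, flipB, flipBit_apply_of_ne h]

theorem Nmat_false_eq_zero_of_ne_A [DecidableEq EA] [DecidableEq EB]
    (z : Bits m) (i : Fin m) (hz : z i = false)
    (r c : Bits m × (Bits m × EA) × (Bits m × EB)) (h : r.1 i ≠ r.2.1.1 i) :
    Nmat m z (fun _ => false) r c = 0 := by
  rw [Nmat_false_apply, Finset.prod_eq_zero (Finset.mem_univ i), mul_zero]
  simp [siteProj, site, hz, Nbit_false_apply, h]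

theorem Nmat_false_eq_zero_of_ne_B [DecidableEq EA] [DecidableEq EB]
    (z : Bits m) (i : Fin m) (hz : z i = true)
    (r c : Bits m × (Bits m × EA) × (Bits m × EB)) (h : r.1 i ≠ r.2.2.1 i) :
    Nmat m z (fun _ => false) r c = 0 := by
  rw [Nmat_false_apply, Finset.prod_eq_zero (Finset.mem_univ i), mul_zero]
  simp [siteProj, site, hz, Nbit_false_apply, h]

theorem one_kronecker_one_kronecker_mulVec [Fintype EA] [Fintype EB] [DecidableEq EA]
    (M : Matrix (Bits m × EB) (Bits m × EB) ℂ)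
    (t : Bits m × (Bits m × EA) × (Bits m × EB) → ℂ) (r) :
    (((1 : Matrix (Bits m) (Bits m) ℂ) ⊗ₖ
      ((1 : Matrix (Bits m × EA) (Bits m × EA) ℂ) ⊗ₖ M)) *ᵥ t) r
      = ∑ b, M r.2.2 b * t (r.1, r.2.1, b) := by
  simp [mulVec, dotProduct, Fintype.sum_prod_type (α₁ := Bits m) (α₂ := (Bits m × EA) × _),
    Fintype.sum_prod_type (α₁ := Bits m × EA), kroneckerMap_apply, one_apply, ite_mul]

theorem one_kronecker_kronecker_one_mulVec [Fintype EA] [Fintype EB] [DecidableEq EB]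
    (M : Matrix (Bits m × EA) (Bits m × EA) ℂ)
    (t : Bits m × (Bits m × EA) × (Bits m × EB) → ℂ) (r) :
    (((1 : Matrix (Bits m) (Bits m) ℂ) ⊗ₖ
      (M ⊗ₖ (1 : Matrix (Bits m × EB) (Bits m × EB) ℂ))) *ᵥ t) r
      = ∑ a, M r.2.1 a * t (r.1, a, r.2.2) := by
  simp [mulVec, dotProduct, Fintype.sum_prod_type (α₁ := Bits m) (α₂ := (Bits m × EA) × _),
    Fintype.sum_prod_type (α₁ := Bits m × EA), kroneckerMap_apply, one_apply, ite_mul]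

/-- The local operator `I ⊗ K ⊗ L` on `V ⊗ A' ⊗ B'`. -/
abbrev localOp (K : Matrix (Bits m × EA) (Bits m × EA) ℂ)
    (L : Matrix (Bits m × EB) (Bits m × EB) ℂ) :
    Matrix (Bits m × (Bits m × EA) × (Bits m × EB)) (Bits m × (Bits m × EA) × (Bits m × EB)) ℂ :=
  (1 : Matrix (Bits m) (Bits m) ℂ) ⊗ₖ (K ⊗ₖ L)

theorem localOp_conjTranspose (K : Matrix (Bits m × EA) (Bits m × EA) ℂ)
    (L : Matrix (Bits m × EB) (Bits m × EB) ℂ) : (localOp K L)ᴴ = localOp Kᴴ Lᴴ := by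
  simp [localOp, conjTranspose_kronecker]

theorem localOp_mul [Fintype EA] [Fintype EB]
    (K K' : Matrix (Bits m × EA) (Bits m × EA) ℂ)
    (L L' : Matrix (Bits m × EB) (Bits m × EB) ℂ) :
    localOp K L * localOp K' L' = localOp (K * K') (L * L') := by
  simp [localOp, ← mul_kronecker_mul]

theorem localOp_conjTranspose_mul_self [Fintype EA] [Fintype EB] [DecidableEq EA] [DecidableEq EB]
    {K : Matrix (Bits m × EA) (Bits m × EA) ℂ}
    {L : Matrix (Bits m × EB) (Bits m × EB) ℂ} (hK : K ∈ unitaryGroup _ ℂ)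
    (hL : L ∈ unitaryGroup _ ℂ) : (localOp K L)ᴴ * localOp K L = 1 := by
  rw [localOp_conjTranspose, localOp_mul, ← star_eq_conjTranspose, ← star_eq_conjTranspose,
    mem_unitaryGroup_iff'.mp hK, mem_unitaryGroup_iff'.mp hL]
  simp [localOp]

/-- The overlap of the winning branches for `z` and `z'` gains a factor `1 / 2` for each position
routed to `A'` by `z` and to `B'` by the other string. -/
theorem norm_inner_branch_le [Fintype EA] [Fintype EB] [DecidableEq EA] [DecidableEq EB]
    (z z' : Bits m) (K K' : Matrix (Bits m × EA) (Bits m × EA) ℂ)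
    (L L' : Matrix (Bits m × EB) (Bits m × EB) ℂ) (hK : K ∈ unitaryGroup _ ℂ)
    (hK' : K' ∈ unitaryGroup _ ℂ) (hL : L ∈ unitaryGroup _ ℂ) (hL' : L' ∈ unitaryGroup _ ℂ)
    (φ φ' : Bits m × (Bits m × EA) × (Bits m × EB) → ℂ) :
    ‖inner ℂ (WithLp.toLp 2 ((localOp K L)ᴴ *ᵥ (Nmat m z (fun _ => false) *ᵥ φ)))
        (WithLp.toLp 2 ((localOp K' L')ᴴ *ᵥ (Nmat m z' (fun _ => false) *ᵥ φ')))‖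
      ≤ (1 / 2) ^ (univ.filter fun i => z i = false ∧ z' i = true).card *
        (‖WithLp.toLp 2 ((localOp K L)ᴴ *ᵥ (Nmat m z (fun _ => false) *ᵥ φ))‖ *
          ‖WithLp.toLp 2 ((localOp K' L')ᴴ *ᵥ (Nmat m z' (fun _ => false) *ᵥ φ'))‖) := by
  set t := Nmat m z (fun _ => false) *ᵥ φ with ht
  set t' := Nmat m z' (fun _ => false) *ᵥ φ' with ht'
  have hM : L' * Lᴴ ∈ unitaryGroup _ ℂ := mul_mem hL' (Unitary.star_mem hL)
  have hM' : K * K'ᴴ ∈ unitaryGroup _ ℂ := mul_mem hK (Unitary.star_mem hK')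
  have hinner : inner ℂ (WithLp.toLp 2 ((localOp K L)ᴴ *ᵥ t))
      (WithLp.toLp 2 ((localOp K' L')ᴴ *ᵥ t')) =
      inner ℂ (WithLp.toLp 2 (localOp 1 (L' * Lᴴ) *ᵥ t))
        (WithLp.toLp 2 (localOp (K * K'ᴴ) 1 *ᵥ t')) := by
    rw [inner_toLp_mulVec_mulVec, inner_toLp_mulVec_mulVec]
    simp only [localOp_conjTranspose, localOp_mul, conjTranspose_mul, conjTranspose_conjTranspose,
      conjTranspose_one, one_mul, mul_one]
  have hstar : ∀ {K : Matrix (Bits m × EA) (Bits m × EA) ℂ}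
      {L : Matrix (Bits m × EB) (Bits m × EB) ℂ}, K ∈ unitaryGroup _ ℂ → L ∈ unitaryGroup _ ℂ →
      ∀ w, ‖WithLp.toLp 2 ((localOp K L)ᴴ *ᵥ w)‖ = ‖WithLp.toLp 2 w‖ := fun h1 h2 w => by
    rw [localOp_conjTranspose]
    exact norm_toLp_mulVec_of_conjTranspose_mul_eq_one _
      (localOp_conjTranspose_mul_self (Unitary.star_mem h1) (Unitary.star_mem h2)) w
  rw [hinner, hstar hK hL, hstar hK' hL',
    ← norm_toLp_mulVec_of_conjTranspose_mul_eq_one _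
      (localOp_conjTranspose_mul_self (one_mem _) hM) t,
    ← norm_toLp_mulVec_of_conjTranspose_mul_eq_one _
      (localOp_conjTranspose_mul_self hM' (one_mem _)) t']
  refine norm_inner_le_half_pow _ flipA flipB ?_ ?_ (fun i r => r.2.1.1 i = r.2.2.1 i)
    ?_ ?_ ?_ ?_ _ _ ?_ ?_ ?_
  · intro i r; simp [flipA, flipBit_involutive i _]
  · intro i r; simp [flipB, flipBit_involutive i _]
  · intro i r
    simp only [flipA, flipBit_apply_self]
    cases r.2.1.1 i <;> cases r.2.2.1 i <;> simp
  · intro i j r h; simp only [flipA, flipBit_apply_of_ne h]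
  · intro i r
    simp only [flipB, flipBit_apply_self]
    cases r.2.1.1 i <;> cases r.2.2.1 i <;> simp
  · intro i j r h; simp only [flipB, flipBit_apply_of_ne h]
  · intro i hi r
    rw [one_kronecker_one_kronecker_mulVec, one_kronecker_one_kronecker_mulVec]
    refine Finset.sum_congr rfl fun b _ => ?_
    congr 1
    exact Finset.sum_congr rfl fun c _ => congrArg (· * φ c)
      (Nmat_false_flipA z i (Finset.mem_filter.mp hi).2.1 (r.1, r.2.1, b) c)
  · intro i hi r
    rw [one_kronecker_kronecker_one_mulVec, one_kronecker_kronecker_one_mulVec]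
    refine Finset.sum_congr rfl fun a _ => ?_
    congr 1
    exact Finset.sum_congr rfl fun c _ => congrArg (· * φ' c)
      (Nmat_false_flipB z' i (Finset.mem_filter.mp hi).2.2 (r.1, a, r.2.2) c)
  · intro r i hi hne
    obtain ⟨-, hz, hz'⟩ := Finset.mem_filter.mp hi
    rw [one_kronecker_one_kronecker_mulVec, one_kronecker_kronecker_one_mulVec]
    by_cases h : r.1 i = r.2.1.1 i
    · right
      refine Finset.sum_eq_zero fun a _ => mul_eq_zero_of_right _ ?_
      exact Finset.sum_eq_zero fun c _ => mul_eq_zero_of_left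
        (Nmat_false_eq_zero_of_ne_B z' i hz' (r.1, a, r.2.2) c fun h' => hne (h.symm.trans h')) _
    · left
      refine Finset.sum_eq_zero fun b _ => mul_eq_zero_of_right _ ?_
      exact Finset.sum_eq_zero fun c _ => mul_eq_zero_of_left
        (Nmat_false_eq_zero_of_ne_A z i hz (r.1, r.2.1, b) c h) _

end

/-- `(1/√2)` to the Hamming distance of `z` and `z'`. -/
def hammingKernel {m : ℕ} (z z' : Bits m) : ℝ :=
  ∏ i, if z i = z' i then 1 else 1 / Real.sqrt 2

theorem hammingKernel_comm {m : ℕ} (z z' : Bits m) : hammingKernel z z' = hammingKernel z' z := by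
  simp only [hammingKernel, eq_comm]

theorem hammingKernel_nonneg {m : ℕ} (z z' : Bits m) : 0 ≤ hammingKernel z z' :=
  Finset.prod_nonneg fun i _ => by split_ifs <;> positivity

theorem sum_hammingKernel {m : ℕ} (z : Bits m) :
    ∑ z', hammingKernel z z' = (1 + 1 / Real.sqrt 2) ^ m := by
  simp only [hammingKernel]
  rw [← Fintype.prod_sum fun i b => if z i = b then (1 : ℝ) else 1 / Real.sqrt 2]
  have h : ∀ b : Bool, ∑ b' : Bool, (if b = b' then (1 : ℝ) else 1 / Real.sqrt 2)
      = 1 + 1 / Real.sqrt 2 := by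
    intro b; cases b <;> simp [add_comm]
  simp only [h, Finset.prod_const, Finset.card_univ, Fintype.card_fin]

theorem min_half_pow_le_hammingKernel {m : ℕ} (z z' : Bits m) :
    min ((1 / 2 : ℝ) ^ (univ.filter fun i => z i = false ∧ z' i = true).card)
      ((1 / 2) ^ (univ.filter fun i => z' i = false ∧ z i = true).card) ≤ hammingKernel z z' := by
  set k := (univ.filter fun i => z i = false ∧ z' i = true).card with hk
  set l := (univ.filter fun i => z' i = false ∧ z i = true).card with hl
  have hker : hammingKernel z z' = (1 / Real.sqrt 2) ^ (k + l) := by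
    rw [hammingKernel, Finset.prod_ite]
    have : (univ.filter fun i => ¬ z i = z' i) =
        (univ.filter fun i => z i = false ∧ z' i = true) ∪
          (univ.filter fun i => z' i = false ∧ z i = true) := by
      ext i
      cases hz : z i <;> cases hz' : z' i <;> simp [hz, hz']
    rw [this, Finset.prod_const_one, one_mul, Finset.prod_const, Finset.card_union_of_disjoint]
    refine Finset.disjoint_filter.mpr fun i _ h h' => ?_
    simp [h.1] at h'
  have hhalf : (1 / 2 : ℝ) = (1 / Real.sqrt 2) ^ 2 := by
    rw [div_pow, Real.sq_sqrt (by norm_num), one_pow]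
  have h0 : 0 ≤ 1 / Real.sqrt 2 := by positivity
  have h1 : 1 / Real.sqrt 2 ≤ 1 := by
    rw [div_le_one (by positivity)]
    exact Real.one_le_sqrt.mpr (by norm_num)
  rw [hker, hhalf, ← pow_mul, ← pow_mul]
  rcases le_total k l with h | h
  · exact (min_le_right _ _).trans (pow_le_pow_of_le_one h0 h1 (by omega))
  · exact (min_le_left _ _).trans (pow_le_pow_of_le_one h0 h1 (by omega))

/-- fixed-state bound `(1/2 + 1/(2√2))^m` for the error-free parallel
routing game, for functions reproducing the uniform distribution. -/
theorem stmt12 (n m : ℕ) (f : Bits n × Bits n → Bits m)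
    (hf : ∀ z : Bits m,
      ((Finset.univ.filter (fun p : Bits n × Bits n => f p = z)).card : ℝ) / 2 ^ (2 * n)
        = 1 / 2 ^ m)
    (eA eB : ℕ)
    (ψ : Bits m × (Bits m × Fin eA) × (Bits m × Fin eB) → ℂ) (hψ : ∑ i, ‖ψ i‖ ^ 2 = 1)
    (K : Bits n → Bits n → Matrix (Bits m × Fin eA) (Bits m × Fin eA) ℂ)
    (L : Bits n → Bits n → Matrix (Bits m × Fin eB) (Bits m × Fin eB) ℂ)
    (hK : ∀ x y, K x y ∈ Matrix.unitaryGroup (Bits m × Fin eA) ℂ)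
    (hL : ∀ x y, L x y ∈ Matrix.unitaryGroup (Bits m × Fin eB) ℂ) :
    (1 / 2 ^ (2 * n) : ℝ) * ∑ x : Bits n, ∑ y : Bits n,
      (star (routPsi n m eA eB ψ K L x y) ⬝ᵥ
        (Nmat m (f (x, y)) (fun _ => false)).mulVec (routPsi n m eA eB ψ K L x y)).re
      ≤ (1 / 2 + 1 / (2 * Real.sqrt 2)) ^ m := by
  let J := Bits m × (Bits m × Fin eA) × (Bits m × Fin eB)
  let N : Bits n × Bits n → Matrix J J ℂ := fun p => Nmat m (f p) fun _ => false
  let U : Bits n × Bits n → Matrix J J ℂ := fun p => localOp (K p.1 p.2) (L p.1 p.2)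
  let v : Bits n × Bits n → EuclideanSpace ℂ J := fun p =>
    WithLp.toLp 2 ((U p)ᴴ *ᵥ (N p *ᵥ (U p *ᵥ ψ)))
  have hUU : ∀ p, U p * (U p)ᴴ = 1 := fun p => mul_eq_one_comm.mp
    (localOp_conjTranspose_mul_self (hK p.1 p.2) (hL p.1 p.2))
  have hval : ∀ p, inner ℂ (WithLp.toLp 2 ψ) (v p) =
      star (U p *ᵥ ψ) ⬝ᵥ (N p) *ᵥ (U p *ᵥ ψ) := fun p => by
    rw [EuclideanSpace.inner_toLp_toLp, dotProduct_comm, star_mulVec, dotProduct_mulVec]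
  have hnorm : ∀ p, ‖v p‖ ^ 2 = (inner ℂ (WithLp.toLp 2 ψ) (v p)).re := fun p => by
    have hNN : (N p)ᴴ * N p = N p := by
      rw [Nmat_false_conjTranspose, Nmat_false_mul_self]
    rw [hval, ← inner_self_eq_norm_sq (𝕜 := ℂ), inner_toLp_mulVec_mulVec,
      conjTranspose_conjTranspose, hUU, one_mulVec, star_mulVec, ← dotProduct_mulVec,
      mulVec_mulVec, hNN]
    rfl
  have hcard : ∀ z, ((univ.filter fun p => f p = z).card : ℝ) = 2 ^ (2 * n) / 2 ^ m := fun z => by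
    rw [eq_div_iff (by positivity)]
    have := hf z
    rw [div_eq_div_iff (by positivity) (by positivity)] at this
    linarith
  have hrow : ∀ p, ∑ q, hammingKernel (f p) (f q) =
      2 ^ (2 * n) / 2 ^ m * (1 + 1 / Real.sqrt 2) ^ m := fun p => by
    rw [← sum_hammingKernel (f p), Finset.mul_sum,
      ← Finset.sum_fiberwise univ f fun q => hammingKernel (f p) (f q)]
    refine Finset.sum_congr rfl fun z _ => ?_
    rw [← hcard z, ← nsmul_eq_mul, ← Finset.sum_const]
    exact Finset.sum_congr rfl fun q hq => by rw [(Finset.mem_filter.mp hq).2]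
  have hmain := sum_re_inner_le_of_overlap (WithLp.toLp 2 ψ)
    (by rw [EuclideanSpace.norm_eq]; simp [hψ]) v
    (fun p q => hammingKernel (f p) (f q)) (2 ^ (2 * n) / 2 ^ m * (1 + 1 / Real.sqrt 2) ^ m)
    (fun p => (hnorm p).le) (fun p q => hammingKernel_nonneg _ _)
    (fun p q => hammingKernel_comm _ _) (fun p => (hrow p).le)
    (fun p q => by
      have h1 := norm_inner_branch_le (f p) (f q) _ _ _ _ (hK p.1 p.2) (hK q.1 q.2) (hL p.1 p.2)
        (hL q.1 q.2) (U p *ᵥ ψ) (U q *ᵥ ψ)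
      have h2 := norm_inner_branch_le (f q) (f p) _ _ _ _ (hK q.1 q.2) (hK p.1 p.2) (hL q.1 q.2)
        (hL p.1 p.2) (U q *ᵥ ψ) (U p *ᵥ ψ)
      rw [norm_inner_symm, mul_comm ‖_‖] at h2
      refine le_trans ?_ (mul_le_mul_of_nonneg_right (min_half_pow_le_hammingKernel (f p) (f q))
        (by positivity))
      rw [min_mul_of_nonneg _ _ (by positivity)]
      exact le_min h1 h2)
    (by positivity)
  rw [Fintype.sum_prod_type] at hmain
  simp only [hval] at hmain
  have hconst : (1 / 2 ^ (2 * n) : ℝ) * (2 ^ (2 * n) / 2 ^ m * (1 + 1 / Real.sqrt 2) ^ m) =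
      (1 / 2 + 1 / (2 * Real.sqrt 2)) ^ m := by
    have : (1 / 2 + 1 / (2 * Real.sqrt 2)) = (1 + 1 / Real.sqrt 2) / 2 := by
      field_simp
    rw [this, div_pow]
    field_simp
  rw [← hconst]
  exact mul_le_mul_of_nonneg_left hmain (by positivity)
end
end

section
/- Let n, m ∈ ℕ, γ ∈ [0,1/2), and let f : {0,1}^n × {0,1}^n → {0,1}^m reproduce the uniform distribution over {0,1}^m. Then for all e_A, e_B ∈ ℕ, every unit vector ψ ∈ V ⊗ A' ⊗ B', and every family of unitaries K^{xy} on A' and L^{xy} on B' indexed by (x,y) ∈ {0,1}^n × {0,1}^n, one has 2^{−2n} · Σ_{x,y∈{0,1}^n} Σ_{a∈{0,1}^m : w_H(a) ≤ γm} ⟨Ψ_{xy}, N^{f(x,y)}_a Ψ_{xy}⟩ ≤ (μ_γ)^m, where Ψ_{xy} := (I_V ⊗ K^{xy} ⊗ L^{xy})ψ, w_H denotes Hamming weight, μ_γ := 2^{γ+h(γ)}·(1/2 + 1/(2√2)), and h is the binary entropy function. -/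
open Matrix Kronecker Finset
open scoped ComplexOrder

noncomputable section

open scoped Matrix.Norms.L2Operator

/-- The index set of the computational basis of `V ⊗ A' ⊗ B'`. -/
abbrev RoutIdx (m : ℕ) (EA EB : Type*) := Bits m × (Bits m × EA) × (Bits m × EB)

section Local

/-- A two-qubit operator on `V_i ⊗ A_i`, extended by the identity on `B_i`. -/
def onA (M : Matrix (Bool × Bool) (Bool × Bool) ℂ) :
    Matrix (Bool × Bool × Bool) (Bool × Bool × Bool) ℂ :=
  fun r c => (if r.2.2 = c.2.2 then 1 else 0) * M (r.1, r.2.1) (c.1, c.2.1)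

/-- A two-qubit operator on `V_i ⊗ B_i`, extended by the identity on `A_i`. -/
def onB (M : Matrix (Bool × Bool) (Bool × Bool) ℂ) :
    Matrix (Bool × Bool × Bool) (Bool × Bool × Bool) ℂ :=
  fun r c => (if r.2.1 = c.2.1 then 1 else 0) * M (r.1, r.2.2) (c.1, c.2.2)

lemma onA_mul (M N : Matrix (Bool × Bool) (Bool × Bool) ℂ) : onA (M * N) = onA M * onA N := by
  ext ⟨r, s, t⟩ ⟨r', s', t'⟩
  cases t <;> cases t' <;> simp [onA, Matrix.mul_apply, Fintype.sum_prod_type]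

lemma onB_mul (M N : Matrix (Bool × Bool) (Bool × Bool) ℂ) : onB (M * N) = onB M * onB N := by
  ext ⟨r, s, t⟩ ⟨r', s', t'⟩
  cases s <;> cases s' <;> simp [onB, Matrix.mul_apply, Fintype.sum_prod_type]

lemma onA_star (M : Matrix (Bool × Bool) (Bool × Bool) ℂ) : star (onA M) = onA (star M) := by
  ext ⟨r, s, t⟩ ⟨r', s', t'⟩
  cases t <;> cases t' <;> simp [onA, Matrix.star_apply]

lemma onB_star (M : Matrix (Bool × Bool) (Bool × Bool) ℂ) : star (onB M) = onB (star M) := by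
  ext ⟨r, s, t⟩ ⟨r', s', t'⟩
  cases s <;> cases s' <;> simp [onB, Matrix.star_apply]

lemma IsStarProjection.onA {M : Matrix (Bool × Bool) (Bool × Bool) ℂ} (h : IsStarProjection M) :
    IsStarProjection (onA M) :=
  ⟨by rw [IsIdempotentElem, ← onA_mul, h.isIdempotentElem.eq],
   by rw [IsSelfAdjoint, onA_star, h.isSelfAdjoint.star_eq]⟩

lemma IsStarProjection.onB {M : Matrix (Bool × Bool) (Bool × Bool) ℂ} (h : IsStarProjection M) :
    IsStarProjection (onB M) :=
  ⟨by rw [IsIdempotentElem, ← onB_mul, h.isIdempotentElem.eq],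
   by rw [IsSelfAdjoint, onB_star, h.isSelfAdjoint.star_eq]⟩

lemma projPhiPlus_apply (p q : Bool × Bool) :
    projPhiPlus p q = if p.1 = p.2 ∧ q.1 = q.2 then 1 / 2 else 0 := by
  have h : ((Real.sqrt 2 : ℂ))⁻¹ * ((Real.sqrt 2 : ℂ))⁻¹ = 1 / 2 := by
    rw [← mul_inv, ← Complex.ofReal_mul, Real.mul_self_sqrt (by norm_num)]
    norm_num
  by_cases h₁ : p.1 = p.2 <;> by_cases h₂ : q.1 = q.2 <;>
    simp [projPhiPlus, Matrix.vecMulVec_apply, phiPlus, h₁, h₂]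
  simpa using h

lemma isStarProjection_projPhiPlus : IsStarProjection projPhiPlus := by
  constructor
  · ext ⟨r, s⟩ ⟨r', s'⟩
    simp only [Matrix.mul_apply, projPhiPlus_apply, Fintype.sum_prod_type, Fintype.sum_bool]
    cases r <;> cases s <;> cases r' <;> cases s' <;> norm_num
  · ext ⟨r, s⟩ ⟨r', s'⟩
    simp only [Matrix.star_apply, projPhiPlus_apply]
    cases r <;> cases s <;> cases r' <;> cases s' <;> norm_num

lemma isStarProjection_Nbit (a : Bool) : IsStarProjection (Nbit a) := by
  cases a
  · exact isStarProjection_projPhiPlus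
  · exact isStarProjection_projPhiPlus.one_sub

/-- Monogamy of entanglement for a single qubit. -/
lemma onA_mul_onB_mul_onA_projPhiPlus :
    onA projPhiPlus * onB projPhiPlus * onA projPhiPlus = (1 / 4 : ℂ) • onA projPhiPlus := by
  ext ⟨r, s, t⟩ ⟨r', s', t'⟩
  simp only [Matrix.mul_apply, onA, onB, projPhiPlus_apply, Fintype.sum_prod_type,
    Fintype.sum_bool, Matrix.smul_apply]
  cases r <;> cases s <;> cases t <;> cases r' <;> cases s' <;> cases t' <;> norm_num

end Local

section Lift

variable {m : ℕ} {EA EB : Type*}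

/-- An operator on `A'`, extended by the identity on `V` and `B'`. -/
def liftA (EB : Type*) [DecidableEq EB] (K : Matrix (Bits m × EA) (Bits m × EA) ℂ) :
    Matrix (RoutIdx m EA EB) (RoutIdx m EA EB) ℂ :=
  (1 : Matrix (Bits m) (Bits m) ℂ) ⊗ₖ (K ⊗ₖ (1 : Matrix (Bits m × EB) (Bits m × EB) ℂ))

/-- An operator on `B'`, extended by the identity on `V` and `A'`. -/
def liftB (EA : Type*) [DecidableEq EA] (L : Matrix (Bits m × EB) (Bits m × EB) ℂ) :
    Matrix (RoutIdx m EA EB) (RoutIdx m EA EB) ℂ :=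
  (1 : Matrix (Bits m) (Bits m) ℂ) ⊗ₖ ((1 : Matrix (Bits m × EA) (Bits m × EA) ℂ) ⊗ₖ L)

lemma liftA_star [DecidableEq EB] (K : Matrix (Bits m × EA) (Bits m × EA) ℂ) :
    star (liftA EB K) = liftA EB (star K) := by
  simp [liftA, Matrix.star_eq_conjTranspose, Matrix.conjTranspose_kronecker]

lemma liftB_star [DecidableEq EA] (L : Matrix (Bits m × EB) (Bits m × EB) ℂ) :
    star (liftB EA L) = liftB EA (star L) := by
  simp [liftB, Matrix.star_eq_conjTranspose, Matrix.conjTranspose_kronecker]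

variable [DecidableEq EA] [DecidableEq EB] [Fintype EA] [Fintype EB]

lemma commute_liftA_liftB (K : Matrix (Bits m × EA) (Bits m × EA) ℂ)
    (L : Matrix (Bits m × EB) (Bits m × EB) ℂ) : Commute (liftA EB K) (liftB EA L) := by
  simp only [Commute, SemiconjBy, liftA, liftB, ← Matrix.mul_kronecker_mul, mul_one, one_mul]

lemma liftA_mul_liftB (K : Matrix (Bits m × EA) (Bits m × EA) ℂ)
    (L : Matrix (Bits m × EB) (Bits m × EB) ℂ) :
    liftA EB K * liftB EA L = (1 : Matrix (Bits m) (Bits m) ℂ) ⊗ₖ (K ⊗ₖ L) := by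
  simp only [liftA, liftB, ← Matrix.mul_kronecker_mul, mul_one, one_mul]

lemma liftA_mem_unitary {K : Matrix (Bits m × EA) (Bits m × EA) ℂ}
    (hK : K ∈ Matrix.unitaryGroup (Bits m × EA) ℂ) :
    liftA EB K ∈ unitary (Matrix (RoutIdx m EA EB) (RoutIdx m EA EB) ℂ) :=
  Matrix.kronecker_mem_unitary (one_mem _) (Matrix.kronecker_mem_unitary hK (one_mem _))

lemma liftB_mem_unitary {L : Matrix (Bits m × EB) (Bits m × EB) ℂ}
    (hL : L ∈ Matrix.unitaryGroup (Bits m × EB) ℂ) :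
    liftB EA L ∈ unitary (Matrix (RoutIdx m EA EB) (RoutIdx m EA EB) ℂ) :=
  Matrix.kronecker_mem_unitary (one_mem _) (Matrix.kronecker_mem_unitary (one_mem _) hL)

end Lift

section Qubitwise

variable {m : ℕ} {EA EB : Type*} [DecidableEq EA] [DecidableEq EB]

/-- The tensor product over `i` of operators `M i` on `V_i ⊗ A_i ⊗ B_i`, extended by the identity
on the ancillas. -/
def qubitwise (EA EB : Type*) [DecidableEq EA] [DecidableEq EB]
    (M : Fin m → Matrix (Bool × Bool × Bool) (Bool × Bool × Bool) ℂ) :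
    Matrix (RoutIdx m EA EB) (RoutIdx m EA EB) ℂ :=
  fun r c =>
    (if r.2.1.2 = c.2.1.2 then 1 else 0) * (if r.2.2.2 = c.2.2.2 then 1 else 0) *
      ∏ i, M i (r.1 i, r.2.1.1 i, r.2.2.1 i) (c.1 i, c.2.1.1 i, c.2.2.1 i)

/-- Regroup the three registers qubit by qubit. -/
def routIdxEquiv (m : ℕ) (EA EB : Type*) :
    (Fin m → Bool × Bool × Bool) × EA × EB ≃ RoutIdx m EA EB where
  toFun p := (fun i => (p.1 i).1, (fun i => (p.1 i).2.1, p.2.1), (fun i => (p.1 i).2.2, p.2.2))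
  invFun r := (fun i => (r.1 i, r.2.1.1 i, r.2.2.1 i), r.2.1.2, r.2.2.2)
  left_inv _ := rfl
  right_inv _ := rfl

lemma qubitwise_mul [Fintype EA] [Fintype EB]
    (M N : Fin m → Matrix (Bool × Bool × Bool) (Bool × Bool × Bool) ℂ) :
    qubitwise EA EB M * qubitwise EA EB N = qubitwise EA EB (fun i => M i * N i) := by
  ext r c
  rw [Matrix.mul_apply, ← (routIdxEquiv m EA EB).sum_comp, Fintype.sum_prod_type]
  simp only [qubitwise, routIdxEquiv, Equiv.coe_fn_mk, Matrix.mul_apply, Prod.mk.eta,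
    Fintype.sum_prod_type (α₁ := EA)]
  rw [Finset.prod_univ_sum, Finset.mul_sum, Fintype.piFinset_univ]
  refine Finset.sum_congr rfl fun g _ => ?_
  rw [Finset.prod_mul_distrib]
  by_cases h₁ : r.2.1.2 = c.2.1.2
  · by_cases h₂ : r.2.2.2 = c.2.2.2
    · simp [h₁, h₂]
    · rw [if_neg h₂, mul_zero, zero_mul]
      refine Finset.sum_eq_zero fun x _ => Finset.sum_eq_zero fun y _ => ?_
      by_cases hy : r.2.2.2 = y
      · simp [← hy, h₂]
      · simp [hy]
  · rw [if_neg h₁, zero_mul, zero_mul]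
    refine Finset.sum_eq_zero fun x _ => Finset.sum_eq_zero fun y _ => ?_
    by_cases hx : r.2.1.2 = x
    · simp [← hx, h₁]
    · simp [hx]

lemma qubitwise_star (M : Fin m → Matrix (Bool × Bool × Bool) (Bool × Bool × Bool) ℂ) :
    star (qubitwise EA EB M) = qubitwise EA EB (fun i => star (M i)) := by
  ext r c
  simp only [Matrix.star_apply, qubitwise, star_mul', star_prod, eq_comm (a := c.2.1.2),
    eq_comm (a := c.2.2.2), apply_ite star, star_one, star_zero]

lemma qubitwise_smul (k : Fin m → ℂ)
    (M : Fin m → Matrix (Bool × Bool × Bool) (Bool × Bool × Bool) ℂ) :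
    qubitwise EA EB (fun i => k i • M i) = (∏ i, k i) • qubitwise EA EB M := by
  ext r c
  simp only [qubitwise, Matrix.smul_apply, smul_eq_mul, Finset.prod_mul_distrib]
  ring

lemma isStarProjection_qubitwise [Fintype EA] [Fintype EB]
    {M : Fin m → Matrix (Bool × Bool × Bool) (Bool × Bool × Bool) ℂ}
    (h : ∀ i, IsStarProjection (M i)) : IsStarProjection (qubitwise EA EB M) :=
  ⟨by simp only [IsIdempotentElem, qubitwise_mul, (h _).isIdempotentElem.eq],
   by simp only [IsSelfAdjoint, qubitwise_star, (h _).isSelfAdjoint.star_eq]⟩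

lemma Nmat_eq_qubitwise (z a : Bits m) :
    (Nmat m z a : Matrix (RoutIdx m EA EB) (RoutIdx m EA EB) ℂ) =
      qubitwise EA EB (fun i => if z i then onB (Nbit (a i)) else onA (Nbit (a i))) := by
  ext r c
  simp only [Nmat, qubitwise]
  congr 1
  refine Finset.prod_congr rfl fun i _ => ?_
  split_ifs <;> simp_all [onA, onB]

lemma isStarProjection_Nmat [Fintype EA] [Fintype EB] (z a : Bits m) :
    IsStarProjection (Nmat m z a : Matrix (RoutIdx m EA EB) (RoutIdx m EA EB) ℂ) := by
  rw [Nmat_eq_qubitwise]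
  refine isStarProjection_qubitwise fun i => ?_
  split_ifs
  · exact (isStarProjection_Nbit _).onB
  · exact (isStarProjection_Nbit _).onA

/-- Projection onto EPR pairs between `V` and `A'` at the positions in `T`. -/
def eprA (EA EB : Type*) [DecidableEq EA] [DecidableEq EB] (T : Finset (Fin m)) :
    Matrix (RoutIdx m EA EB) (RoutIdx m EA EB) ℂ :=
  qubitwise EA EB (fun i => if i ∈ T then onA projPhiPlus else 1)

/-- Projection onto EPR pairs between `V` and `B'` at the positions in `T`. -/
def eprB (EA EB : Type*) [DecidableEq EA] [DecidableEq EB] (T : Finset (Fin m)) :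
    Matrix (RoutIdx m EA EB) (RoutIdx m EA EB) ℂ :=
  qubitwise EA EB (fun i => if i ∈ T then onB projPhiPlus else 1)

variable [Fintype EA] [Fintype EB]

lemma isStarProjection_eprA (T : Finset (Fin m)) : IsStarProjection (eprA EA EB T) := by
  refine isStarProjection_qubitwise fun i => ?_
  split_ifs
  · exact isStarProjection_projPhiPlus.onA
  · exact .one _

lemma isStarProjection_eprB (T : Finset (Fin m)) : IsStarProjection (eprB EA EB T) := by
  refine isStarProjection_qubitwise fun i => ?_
  split_ifs
  · exact isStarProjection_projPhiPlus.onB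
  · exact .one _

lemma Nmat_mul_eprA {z a : Bits m} {T : Finset (Fin m)}
    (hT : ∀ i ∈ T, z i = false ∧ a i = false) :
    Nmat m z a * eprA EA EB T = Nmat m z a := by
  rw [Nmat_eq_qubitwise, eprA, qubitwise_mul]
  congr 1
  ext1 i
  by_cases hi : i ∈ T
  · simp [hi, hT i hi, Nbit, isStarProjection_projPhiPlus.onA.isIdempotentElem.eq]
  · simp [hi]

lemma eprB_mul_Nmat {z a : Bits m} {T : Finset (Fin m)}
    (hT : ∀ i ∈ T, z i = true ∧ a i = false) :
    eprB EA EB T * Nmat m z a = Nmat m z a := by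
  rw [Nmat_eq_qubitwise, eprB, qubitwise_mul]
  congr 1
  ext1 i
  by_cases hi : i ∈ T
  · simp [hi, hT i hi, Nbit, isStarProjection_projPhiPlus.onB.isIdempotentElem.eq]
  · simp [hi]

lemma eprA_mul_eprB_mul_eprA (T : Finset (Fin m)) :
    eprA EA EB T * eprB EA EB T * eprA EA EB T = (1 / 4 : ℂ) ^ T.card • eprA EA EB T := by
  have h : (1 / 4 : ℂ) ^ T.card = ∏ i : Fin m, if i ∈ T then (1 / 4 : ℂ) else 1 := by
    simp [Finset.prod_ite_mem]
  rw [h, eprA, eprB, ← qubitwise_smul, qubitwise_mul, qubitwise_mul]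
  congr 1
  ext1 i
  split_ifs
  · exact onA_mul_onB_mul_onA_projPhiPlus
  · simp

lemma norm_eprA_mul_eprB_le (T : Finset (Fin m)) :
    ‖eprA EA EB T * eprB EA EB T‖ ≤ (1 / 2) ^ T.card := by
  refine abs_le_of_sq_le_sq' ?_ (by positivity) |>.2
  have h : eprA EA EB T * eprB EA EB T * star (eprA EA EB T * eprB EA EB T) =
      (1 / 4 : ℂ) ^ T.card • eprA EA EB T := by
    rw [star_mul, (isStarProjection_eprA T).isSelfAdjoint.star_eq,
      (isStarProjection_eprB T).isSelfAdjoint.star_eq, ← mul_assoc, mul_assoc (eprA EA EB T),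
      (isStarProjection_eprB T).isIdempotentElem.eq, eprA_mul_eprB_mul_eprA]
  rw [sq, ← CStarRing.norm_self_mul_star, h, norm_smul, norm_pow, ← pow_mul, mul_comm _ 2, pow_mul]
  calc _ ≤ ‖(1 / 4 : ℂ)‖ ^ T.card * 1 := by
        gcongr
        exact (isStarProjection_eprA T).norm_le
    _ = _ := by norm_num

lemma commute_eprA_liftB (T : Finset (Fin m)) (L : Matrix (Bits m × EB) (Bits m × EB) ℂ) :
    Commute (eprA EA EB T) (liftB EA L) := by
  have h (r c : RoutIdx m EA EB) : eprA EA EB T r c =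
      qubitwise EA Unit (fun i => if i ∈ T then onA projPhiPlus else 1)
        (r.1, r.2.1, fun _ => false, ()) (c.1, c.2.1, fun _ => false, ()) *
        if r.2.2 = c.2.2 then 1 else 0 := by
    have key (i : Fin m) : (if i ∈ T then onA projPhiPlus else 1)
        (r.1 i, r.2.1.1 i, r.2.2.1 i) (c.1 i, c.2.1.1 i, c.2.2.1 i) =
        (if i ∈ T then onA projPhiPlus else 1)
          (r.1 i, r.2.1.1 i, false) (c.1 i, c.2.1.1 i, false) *
        if r.2.2.1 i = c.2.2.1 i then 1 else 0 := by
      by_cases hi : i ∈ T <;> by_cases hb : r.2.2.1 i = c.2.2.1 i <;>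
        simp [hi, hb, onA, Matrix.one_apply]
    simp only [eprA, qubitwise, key, Finset.prod_mul_distrib, Finset.prod_boole, Finset.mem_univ,
      true_imp_iff, Prod.ext_iff (x := r.2.2), funext_iff (f := r.2.2.1)]
    by_cases h₁ : ∀ i, r.2.2.1 i = c.2.2.1 i <;> by_cases h₂ : r.2.2.2 = c.2.2.2 <;>
      simp [h₁, h₂]
  ext r c
  simp only [Matrix.mul_apply, h, liftB, Matrix.kroneckerMap_apply, Matrix.one_apply,
    Fintype.sum_prod_type (α₁ := Bits m) (α₂ := (Bits m × EA) × Bits m × EB),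
    Fintype.sum_prod_type (α₁ := Bits m × EA)]
  simp [ite_mul, mul_ite, mul_comm]

lemma commute_eprB_liftA (T : Finset (Fin m)) (K : Matrix (Bits m × EA) (Bits m × EA) ℂ) :
    Commute (eprB EA EB T) (liftA EB K) := by
  have h (r c : RoutIdx m EA EB) : eprB EA EB T r c =
      qubitwise Unit EB (fun i => if i ∈ T then onB projPhiPlus else 1)
        (r.1, (fun _ => false, ()), r.2.2) (c.1, (fun _ => false, ()), c.2.2) *
        if r.2.1 = c.2.1 then 1 else 0 := by
    have key (i : Fin m) : (if i ∈ T then onB projPhiPlus else 1)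
        (r.1 i, r.2.1.1 i, r.2.2.1 i) (c.1 i, c.2.1.1 i, c.2.2.1 i) =
        (if i ∈ T then onB projPhiPlus else 1)
          (r.1 i, false, r.2.2.1 i) (c.1 i, false, c.2.2.1 i) *
        if r.2.1.1 i = c.2.1.1 i then 1 else 0 := by
      by_cases hi : i ∈ T <;> by_cases hb : r.2.1.1 i = c.2.1.1 i <;>
        simp [hi, hb, onB, Matrix.one_apply]
    simp only [eprB, qubitwise, key, Finset.prod_mul_distrib, Finset.prod_boole, Finset.mem_univ,
      true_imp_iff, Prod.ext_iff (x := r.2.1), funext_iff (f := r.2.1.1)]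
    by_cases h₁ : ∀ i, r.2.1.1 i = c.2.1.1 i <;> by_cases h₂ : r.2.1.2 = c.2.1.2 <;>
      simp [h₁, h₂]
  ext r c
  simp only [Matrix.mul_apply, h, liftA, Matrix.kroneckerMap_apply, Matrix.one_apply,
    Fintype.sum_prod_type (α₁ := Bits m) (α₂ := (Bits m × EA) × Bits m × EB),
    Fintype.sum_prod_type (α₁ := Bits m × EA)]
  simp [ite_mul, mul_ite, mul_comm]

lemma norm_le_one_of_mem_unitary {k : Type*} [Fintype k] [DecidableEq k] {U : Matrix k k ℂ}
    (hU : U ∈ unitary (Matrix k k ℂ)) : ‖U‖ ≤ 1 := by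
  have h : ‖U‖ * ‖U‖ ≤ 1 := by
    rw [← CStarRing.norm_star_mul_self, Unitary.star_mul_self_of_mem hU]
    exact (IsStarProjection.one _).norm_le
  nlinarith [norm_nonneg U]

/-- The projector `N^z_a`, conjugated by the local unitaries `K` and `L`. -/
def rotN (z a : Bits m) (K : Matrix (Bits m × EA) (Bits m × EA) ℂ)
    (L : Matrix (Bits m × EB) (Bits m × EB) ℂ) : Matrix (RoutIdx m EA EB) (RoutIdx m EA EB) ℂ :=
  star (liftA EB K * liftB EA L) * Nmat m z a * (liftA EB K * liftB EA L)

lemma isStarProjection_rotN (z a : Bits m) {K : Matrix (Bits m × EA) (Bits m × EA) ℂ}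
    {L : Matrix (Bits m × EB) (Bits m × EB) ℂ} (hK : K ∈ Matrix.unitaryGroup (Bits m × EA) ℂ)
    (hL : L ∈ Matrix.unitaryGroup (Bits m × EB) ℂ) : IsStarProjection (rotN z a K L) := by
  have hU := mul_mem (liftA_mem_unitary (EB := EB) hK) (liftB_mem_unitary (EA := EA) hL)
  rw [rotN]
  set U := liftA EB K * liftB EA L
  have hN : IsStarProjection (Nmat m z a : Matrix (RoutIdx m EA EB) (RoutIdx m EA EB) ℂ) :=
    isStarProjection_Nmat z a
  set N : Matrix (RoutIdx m EA EB) (RoutIdx m EA EB) ℂ := Nmat m z a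
  constructor
  · calc star U * N * U * (star U * N * U) = star U * N * (U * star U) * (N * U) := by
          simp only [mul_assoc]
      _ = star U * (N * N) * U := by
          rw [Unitary.mul_star_self_of_mem hU]; simp only [mul_assoc, one_mul]
      _ = _ := by rw [hN.isIdempotentElem.eq]
  · rw [IsSelfAdjoint, star_mul _ U, star_mul _ N, star_star, hN.isSelfAdjoint.star_eq, mul_assoc]

lemma norm_rotN_mul_rotN_le {z z' a : Bits m} {T : Finset (Fin m)}
    (hT : ∀ i ∈ T, z i = false ∧ z' i = true ∧ a i = false)
    {K K' : Matrix (Bits m × EA) (Bits m × EA) ℂ} {L L' : Matrix (Bits m × EB) (Bits m × EB) ℂ}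
    (hK : K ∈ Matrix.unitaryGroup (Bits m × EA) ℂ)
    (hL : L ∈ Matrix.unitaryGroup (Bits m × EB) ℂ)
    (hK' : K' ∈ Matrix.unitaryGroup (Bits m × EA) ℂ)
    (hL' : L' ∈ Matrix.unitaryGroup (Bits m × EB) ℂ) :
    ‖rotN z a K L * rotN z' a K' L'‖ ≤ (1 / 2) ^ T.card := by
  set k := liftA EB K
  set k' := liftA EB K'
  set l := liftB EA L
  set l' := liftB EA L'
  have uk : k ∈ unitary _ := liftA_mem_unitary hK
  have uk' : k' ∈ unitary _ := liftA_mem_unitary hK'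
  have ul : l ∈ unitary _ := liftB_mem_unitary hL
  have ul' : l' ∈ unitary _ := liftB_mem_unitary hL'
  have e : rotN z a K L * rotN z' a K' L' =
      (star (k * l) * Nmat m z a * (l * star l')) * (eprA EA EB T * eprB EA EB T) *
        ((k * star k') * Nmat m z' a * (k' * l')) := by
    have c₁ : k * l = l * k := commute_liftA_liftB K L
    have c₂ : star l' * star k' = star k' * star l' := by
      rw [← star_mul, ← star_mul, (commute_liftA_liftB K' L').eq]
    have c₃ : k * star l' = star l' * k := by
      rw [liftB_star]; exact commute_liftA_liftB K _
    have c₄ : eprA EA EB T * (l * star l') = l * star l' * eprA EA EB T := by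
      refine (commute_eprA_liftB T L).mul_right ?_
      rw [liftB_star]; exact commute_eprA_liftB T _
    have c₅ : k * star k' * eprB EA EB T = eprB EA EB T * (k * star k') := by
      refine ((commute_eprB_liftA T K).mul_right ?_).symm
      rw [liftA_star]; exact commute_eprB_liftA T _
    calc rotN z a K L * rotN z' a K' L'
        = star (k * l) * (Nmat m z a * eprA EA EB T) * (k * l) *
            (star (k' * l') * (eprB EA EB T * Nmat m z' a) * (k' * l')) := by
          rw [Nmat_mul_eprA fun i hi => ⟨(hT i hi).1, (hT i hi).2.2⟩,
            eprB_mul_Nmat fun i hi => ⟨(hT i hi).2.1, (hT i hi).2.2⟩]; rfl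
      _ = star (k * l) * Nmat m z a * eprA EA EB T * (l * (k * star l') * star k') *
            eprB EA EB T * Nmat m z' a * (k' * l') := by
          rw [c₁, star_mul k' l', c₂, ← mul_assoc l, mul_assoc (l * k), ← c₂]
          simp only [mul_assoc]
      _ = star (k * l) * Nmat m z a * (eprA EA EB T * (l * star l')) *
            ((k * star k') * eprB EA EB T) * Nmat m z' a * (k' * l') := by
          rw [c₃]; simp only [mul_assoc]
      _ = _ := by rw [c₄, c₅]; simp only [mul_assoc]
  rw [e]
  have hN (z : Bits m) : ‖(Nmat m z a : Matrix (RoutIdx m EA EB) (RoutIdx m EA EB) ℂ)‖ ≤ 1 :=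
    (isStarProjection_Nmat z a).norm_le
  have contr {X Y : Matrix (RoutIdx m EA EB) (RoutIdx m EA EB) ℂ} (hX : ‖X‖ ≤ 1) (hY : ‖Y‖ ≤ 1) :
      ‖X * Y‖ ≤ 1 := (norm_mul_le _ _).trans (mul_le_one₀ hX (norm_nonneg _) hY)
  have h₁ := contr (contr (norm_le_one_of_mem_unitary (Unitary.star_mem (mul_mem uk ul))) (hN z))
    (norm_le_one_of_mem_unitary (mul_mem ul (Unitary.star_mem ul')))
  have h₂ := contr (contr (norm_le_one_of_mem_unitary (mul_mem uk (Unitary.star_mem uk'))) (hN z'))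
    (norm_le_one_of_mem_unitary (mul_mem uk' ul'))
  refine (norm_mul_le _ _).trans ((mul_le_of_le_one_right (norm_nonneg _) h₂).trans ?_)
  exact (norm_mul_le _ _).trans
    ((mul_le_of_le_one_left (norm_nonneg _) h₁).trans (norm_eprA_mul_eprB_le T))

/-- The bound on the overlap of the projectors for two target strings `z` and `z'`. -/
def overlapBound (a z z' : Bits m) : ℝ :=
  ∏ i, if a i = false ∧ z i ≠ z' i then 1 / Real.sqrt 2 else 1

lemma norm_rotN_mul_rotN_le_overlapBound (z z' a : Bits m)
    {K K' : Matrix (Bits m × EA) (Bits m × EA) ℂ} {L L' : Matrix (Bits m × EB) (Bits m × EB) ℂ}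
    (hK : K ∈ Matrix.unitaryGroup (Bits m × EA) ℂ)
    (hL : L ∈ Matrix.unitaryGroup (Bits m × EB) ℂ)
    (hK' : K' ∈ Matrix.unitaryGroup (Bits m × EA) ℂ)
    (hL' : L' ∈ Matrix.unitaryGroup (Bits m × EB) ℂ) :
    ‖rotN z a K L * rotN z' a K' L'‖ ≤ overlapBound a z z' := by
  set T := Finset.univ.filter fun i => z i = false ∧ z' i = true ∧ a i = false with hT
  set T' := Finset.univ.filter fun i => z' i = false ∧ z i = true ∧ a i = false with hT'
  have h₁ : ‖rotN z a K L * rotN z' a K' L'‖ ≤ (1 / 2) ^ T.card :=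
    norm_rotN_mul_rotN_le (fun i hi => by simpa [hT] using hi) hK hL hK' hL'
  have h₂ : ‖rotN z a K L * rotN z' a K' L'‖ ≤ (1 / 2) ^ T'.card := by
    rw [← norm_star, star_mul, (isStarProjection_rotN z a hK hL).isSelfAdjoint.star_eq,
      (isStarProjection_rotN z' a hK' hL').isSelfAdjoint.star_eq]
    exact norm_rotN_mul_rotN_le (fun i hi => by simpa [hT'] using hi) hK' hL' hK hL
  have hsq : overlapBound a z z' ^ 2 = (1 / 2) ^ T.card * (1 / 2) ^ T'.card := by
    have hc (S : Finset (Fin m)) : (1 / 2 : ℝ) ^ S.card = ∏ i, if i ∈ S then (1 / 2 : ℝ) else 1 := by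
      simp [Finset.prod_ite_mem]
    rw [hc, hc, overlapBound, ← Finset.prod_pow, ← Finset.prod_mul_distrib]
    refine Finset.prod_congr rfl fun i _ => ?_
    cases hz : z i <;> cases hz' : z' i <;> cases ha : a i <;> simp [hT, hT', hz, hz', ha]
  have h0 : 0 ≤ overlapBound a z z' :=
    Finset.prod_nonneg fun i _ => by split_ifs <;> positivity
  refine abs_le_of_sq_le_sq' ?_ h0 |>.2
  rw [hsq, sq]
  exact mul_le_mul h₁ h₂ (norm_nonneg _) (by positivity)

end Qubitwise
section Sums

lemma overlapBound_comm {m : ℕ} (a z z' : Bits m) : overlapBound a z z' = overlapBound a z' z := by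
  simp only [overlapBound, ne_comm]

lemma sum_overlapBound_le {m : ℕ} (a z : Bits m) :
    ∑ z', overlapBound a z z' ≤ 2 ^ hw a * (1 + 1 / Real.sqrt 2) ^ m := by
  have h : ∑ z', overlapBound a z z' =
      ∏ i, ∑ b : Bool, if a i = false ∧ z i ≠ b then 1 / Real.sqrt 2 else 1 := by
    rw [Finset.prod_univ_sum, Fintype.piFinset_univ]
    rfl
  have hs : 0 ≤ 1 / Real.sqrt 2 := by positivity
  calc _ ≤ ∏ i, (if a i = true then 2 else 1) * (1 + 1 / Real.sqrt 2) := by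
        rw [h]
        refine Finset.prod_le_prod (fun i _ => Finset.sum_nonneg fun b _ => ?_) fun i _ => ?_
        · split_ifs <;> positivity
        · cases ha : a i <;> cases hz : z i <;> simp; linarith
    _ = _ := by
        rw [Finset.prod_mul_distrib, Finset.prod_ite]
        simp [hw]

/-- Bound a sum of projections by their pairwise overlaps. -/
lemma sum_re_dotProduct_mulVec_le {ι k : Type*} [Fintype ι] [Nonempty ι] [Fintype k] [DecidableEq k]
    {P : ι → Matrix k k ℂ} (hP : ∀ i, IsStarProjection (P i)) {c : ι → ι → ℝ} {C : ℝ}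
    (hc : ∀ i j, ‖P i * P j‖ ≤ c i j) (hcomm : ∀ i j, c i j = c j i) (hC : ∀ i, ∑ j, c i j ≤ C)
    {ψ : k → ℂ} (hψ : ∑ i, ‖ψ i‖ ^ 2 = 1) :
    ∑ i, (star ψ ⬝ᵥ (P i).mulVec ψ).re ≤ C := by
  set Ψ : EuclideanSpace ℂ k := WithLp.toLp 2 ψ
  set φ : ι → EuclideanSpace ℂ k := fun i => WithLp.toLp 2 ((P i).mulVec ψ)
  have hΨ : ‖Ψ‖ = 1 := by
    have : ‖Ψ‖ ^ 2 = 1 := by rw [EuclideanSpace.norm_sq_eq]; exact hψ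
    nlinarith [norm_nonneg Ψ]
  have hin (i : ι) : star ψ ⬝ᵥ (P i).mulVec ψ = inner ℂ Ψ (φ i) := by
    rw [EuclideanSpace.inner_eq_star_dotProduct, dotProduct_comm]
  have hstar (i : ι) : (P i)ᴴ = P i := (hP i).isSelfAdjoint.star_eq
  have hφ (i j : ι) :
      inner ℂ (φ i) (φ j) = inner ℂ (φ i) (Matrix.toEuclideanCLM (𝕜 := ℂ) (P i * P j) (φ j)) := by
    simp only [EuclideanSpace.inner_eq_star_dotProduct, φ, Matrix.ofLp_toEuclideanCLM,
      Matrix.star_mulVec, hstar, Matrix.mulVec_mulVec]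
    rw [dotProduct_comm, ← Matrix.dotProduct_mulVec, dotProduct_comm _ (star ψ ᵥ* P i),
      ← Matrix.dotProduct_mulVec, Matrix.mulVec_mulVec, Matrix.mulVec_mulVec, mul_assoc (P i),
      (hP j).isIdempotentElem.eq, ← mul_assoc, (hP i).isIdempotentElem.eq]
  have hdiag (i : ι) : (inner ℂ Ψ (φ i)).re = ‖φ i‖ ^ 2 := by
    rw [← inner_self_eq_norm_sq (𝕜 := ℂ)]
    change _ = Complex.re _
    congr 1
    simp only [EuclideanSpace.inner_eq_star_dotProduct, φ, Matrix.star_mulVec, hstar, Ψ]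
    rw [dotProduct_comm, dotProduct_comm _ (star ψ ᵥ* P i), ← Matrix.dotProduct_mulVec,
      Matrix.mulVec_mulVec, (hP i).isIdempotentElem.eq]
  have hover (i j : ι) : (inner ℂ (φ i) (φ j)).re ≤ c i j * ((‖φ i‖ ^ 2 + ‖φ j‖ ^ 2) / 2) := by
    have h₁ : (inner ℂ (φ i) (φ j)).re ≤ ‖φ i‖ * (‖P i * P j‖ * ‖φ j‖) := by
      rw [hφ]
      refine (Complex.re_le_norm _).trans ((norm_inner_le_norm _ _).trans ?_)
      gcongr
      rw [Matrix.cstar_norm_def]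
      exact ContinuousLinearMap.le_opNorm _ _
    have h₂ : ‖φ i‖ * ‖φ j‖ ≤ (‖φ i‖ ^ 2 + ‖φ j‖ ^ 2) / 2 := by
      nlinarith [sq_nonneg (‖φ i‖ - ‖φ j‖)]
    calc _ ≤ ‖P i * P j‖ * (‖φ i‖ * ‖φ j‖) := h₁.trans_eq (by ring)
      _ ≤ _ := mul_le_mul (hc i j) h₂ (by positivity) ((norm_nonneg _).trans (hc i j))
  set S := ∑ i, ‖φ i‖ ^ 2 with hS
  have hS0 : 0 ≤ S := Finset.sum_nonneg fun i _ => by positivity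
  have hSle : S ≤ ‖∑ i, φ i‖ := by
    calc S = (inner ℂ Ψ (∑ i, φ i)).re := by
          rw [inner_sum, Complex.re_sum]; simp only [hdiag, hS]
      _ ≤ ‖Ψ‖ * ‖∑ i, φ i‖ := (Complex.re_le_norm _).trans (norm_inner_le_norm _ _)
      _ = _ := by rw [hΨ, one_mul]
  have hsq : ‖∑ i, φ i‖ ^ 2 ≤ C * S := by
    calc ‖∑ i, φ i‖ ^ 2 = ∑ i, ∑ j, (inner ℂ (φ i) (φ j)).re := by
          rw [← inner_self_eq_norm_sq (𝕜 := ℂ)]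
          simp only [sum_inner, inner_sum, map_sum]
          exact Finset.sum_comm
      _ ≤ ∑ i, ∑ j, c i j * ((‖φ i‖ ^ 2 + ‖φ j‖ ^ 2) / 2) :=
          Finset.sum_le_sum fun i _ => Finset.sum_le_sum fun j _ => hover i j
      _ = (∑ i, ∑ j, c i j * ‖φ i‖ ^ 2 + ∑ i, ∑ j, c i j * ‖φ j‖ ^ 2) / 2 := by
          simp only [← Finset.sum_add_distrib, Finset.sum_div]
          exact Finset.sum_congr rfl fun i _ => Finset.sum_congr rfl fun j _ => by ring
      _ = ∑ i, (∑ j, c i j) * ‖φ i‖ ^ 2 := by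
          rw [Finset.sum_comm (f := fun i j => c i j * ‖φ j‖ ^ 2)]
          simp only [fun i j => hcomm j i, Finset.sum_mul]
          ring
      _ ≤ ∑ i, C * ‖φ i‖ ^ 2 := Finset.sum_le_sum fun i _ => by gcongr; exact hC i
      _ = C * S := by rw [hS, Finset.mul_sum]
  have hgoal : ∑ i, (star ψ ⬝ᵥ (P i).mulVec ψ).re = S := by simp only [hin, hdiag, hS]
  rw [hgoal]
  obtain ⟨i⟩ := ‹Nonempty ι›
  have hC0 : 0 ≤ C :=
    (Finset.sum_nonneg fun j _ => (norm_nonneg _).trans (hc i j)).trans (hC i)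
  nlinarith [sq_nonneg (S - C), mul_self_le_mul_self hS0 hSle]

/-- The volume of a Hamming ball of radius `γ m`. -/
lemma card_hw_le {m : ℕ} {γ : ℝ} (hγ0 : 0 ≤ γ) (hγ1 : γ < 1 / 2) :
    ((Finset.univ.filter fun a : Bits m => (hw a : ℝ) ≤ γ * m).card : ℝ) ≤
      2 ^ (binEnt γ * m) := by
  rcases hγ0.eq_or_lt with rfl | hγ
  · have : (Finset.univ.filter fun a : Bits m => (hw a : ℝ) ≤ 0 * m).card ≤ 1 := by
      refine Finset.card_le_one.2 fun a ha b hb => ?_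
      simp only [zero_mul, Finset.mem_filter, Finset.mem_univ, true_and, Nat.cast_nonpos, hw,
        Finset.card_eq_zero, Finset.filter_eq_empty_iff] at ha hb
      ext i
      have h₁ := @ha i
      have h₂ := @hb i
      simp_all
    simpa [binEnt] using this
  have h1γ : 0 < 1 - γ := by linarith
  have hent : (2 : ℝ) ^ (-(binEnt γ * m)) = γ ^ (γ * m) * (1 - γ) ^ ((1 - γ) * m) := by
    have h2 (p : ℝ) (hp : 0 < p) (t : ℝ) : p ^ t = 2 ^ (Real.logb 2 p * t) := by
      rw [Real.rpow_mul (by norm_num), Real.rpow_logb (by norm_num) (by norm_num) hp]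
    rw [h2 γ hγ, h2 _ h1γ, ← Real.rpow_add (by norm_num), binEnt]
    congr 1
    ring
  have htot : ∑ a : Bits m, γ ^ hw a * (1 - γ) ^ (m - hw a) = 1 := by
    have h : ∏ _i : Fin m, ∑ b : Bool, (if b = true then γ else 1 - γ) = 1 := by simp
    rw [Finset.prod_univ_sum, Fintype.piFinset_univ] at h
    refine Eq.trans ?_ h
    refine Finset.sum_congr rfl fun a _ => ?_
    rw [Finset.prod_ite, Finset.prod_const, Finset.prod_const, Finset.filter_not,
      Finset.card_sdiff_of_subset (Finset.filter_subset _ _)]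
    simp [hw]
  have hterm (a : Bits m) (ha : (hw a : ℝ) ≤ γ * m) :
      (2 : ℝ) ^ (-(binEnt γ * m)) ≤ γ ^ hw a * (1 - γ) ^ (m - hw a) := by
    have hle : hw a ≤ m := (Finset.card_le_univ _).trans_eq (by simp)
    have hexp : (1 - γ) * m = (m - hw a : ℝ) + (hw a - γ * m) := by ring
    have hexp' : γ * m = hw a + (γ * m - hw a) := by ring
    rw [hent, ← Real.rpow_natCast, ← Real.rpow_natCast, Nat.cast_sub hle]
    have hratio : γ ^ (γ * m - hw a) ≤ (1 - γ) ^ (γ * m - hw a) :=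
      Real.rpow_le_rpow hγ.le (by linarith) (by linarith)
    calc γ ^ (γ * m) * (1 - γ) ^ ((1 - γ) * m)
        = γ ^ (hw a : ℝ) * γ ^ (γ * m - hw a) * (1 - γ) ^ ((1 - γ) * m) := by
          rw [← Real.rpow_add hγ]; congr 2
      _ ≤ γ ^ (hw a : ℝ) * (1 - γ) ^ (γ * m - hw a) * (1 - γ) ^ ((1 - γ) * m) := by gcongr
      _ = _ := by
          rw [mul_assoc, ← Real.rpow_add h1γ]; congr 2; ring
  have hsum : (Finset.univ.filter fun a : Bits m => (hw a : ℝ) ≤ γ * m).card *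
      (2 : ℝ) ^ (-(binEnt γ * m)) ≤ 1 := by
    rw [← nsmul_eq_mul, ← Finset.sum_const, ← htot]
    refine (Finset.sum_le_sum fun a ha => hterm a (Finset.mem_filter.1 ha).2).trans ?_
    exact Finset.sum_le_sum_of_subset_of_nonneg (Finset.filter_subset _ _)
      fun a _ _ => by positivity
  rwa [Real.rpow_neg (by norm_num), ← div_eq_mul_inv, div_le_one (by positivity)] at hsum

end Sums

/-- error-robust fixed-state bound `(μ_γ)^m` for the parallel routing
game, for functions reproducing the uniform distribution. -/
theorem stmt13 (n m : ℕ) (γ : ℝ) (hγ0 : 0 ≤ γ) (hγ1 : γ < 1 / 2)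
    (f : Bits n × Bits n → Bits m)
    (hf : ∀ z : Bits m,
      ((Finset.univ.filter (fun p : Bits n × Bits n => f p = z)).card : ℝ) / 2 ^ (2 * n)
        = 1 / 2 ^ m)
    (eA eB : ℕ)
    (ψ : Bits m × (Bits m × Fin eA) × (Bits m × Fin eB) → ℂ) (hψ : ∑ i, ‖ψ i‖ ^ 2 = 1)
    (K : Bits n → Bits n → Matrix (Bits m × Fin eA) (Bits m × Fin eA) ℂ)
    (L : Bits n → Bits n → Matrix (Bits m × Fin eB) (Bits m × Fin eB) ℂ)
    (hK : ∀ x y, K x y ∈ Matrix.unitaryGroup (Bits m × Fin eA) ℂ)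
    (hL : ∀ x y, L x y ∈ Matrix.unitaryGroup (Bits m × Fin eB) ℂ) :
    (1 / 2 ^ (2 * n) : ℝ) * ∑ x : Bits n, ∑ y : Bits n,
      ∑ a ∈ Finset.univ.filter (fun a : Bits m => (hw a : ℝ) ≤ γ * m),
        (star (routPsi n m eA eB ψ K L x y) ⬝ᵥ
          (Nmat m (f (x, y)) a).mulVec (routPsi n m eA eB ψ K L x y)).re
      ≤ muGamma γ ^ m := by
  have hbound (a : Bits m) : ∑ p : Bits n × Bits n,
      (star (routPsi n m eA eB ψ K L p.1 p.2) ⬝ᵥ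
        (Nmat m (f p) a).mulVec (routPsi n m eA eB ψ K L p.1 p.2)).re ≤
      2 ^ (2 * n) / 2 ^ m * (2 ^ hw a * (1 + 1 / Real.sqrt 2) ^ m) := by
    have hrot (p : Bits n × Bits n) : star (routPsi n m eA eB ψ K L p.1 p.2) ⬝ᵥ
        (Nmat m (f p) a).mulVec (routPsi n m eA eB ψ K L p.1 p.2) =
        star ψ ⬝ᵥ (rotN (f p) a (K p.1 p.2) (L p.1 p.2)).mulVec ψ := by
      rw [routPsi, ← liftA_mul_liftB, Matrix.star_mulVec, Matrix.mulVec_mulVec,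
        ← Matrix.dotProduct_mulVec, Matrix.mulVec_mulVec, rotN, mul_assoc,
        Matrix.star_eq_conjTranspose]
    simp only [hrot]
    refine sum_re_dotProduct_mulVec_le
      (c := fun p q : Bits n × Bits n => overlapBound a (f p) (f q))
      (fun p => isStarProjection_rotN _ _ (hK _ _) (hL _ _))
      (fun p q => norm_rotN_mul_rotN_le_overlapBound _ _ _ (hK _ _) (hL _ _) (hK _ _) (hL _ _))
      (fun p q => overlapBound_comm _ _ _) (fun p => ?_) hψ
    have hcard (z : Bits m) :
        ((Finset.univ.filter (fun q : Bits n × Bits n => f q = z)).card : ℝ) =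
          2 ^ (2 * n) / 2 ^ m := by
      have h := hf z
      field_simp at h ⊢
      linarith
    calc ∑ q, overlapBound a (f p) (f q)
        = ∑ z', 2 ^ (2 * n) / 2 ^ m * overlapBound a (f p) z' := by
          rw [← Finset.sum_fiberwise Finset.univ f]
          refine Finset.sum_congr rfl fun z' _ => ?_
          rw [← hcard z', ← nsmul_eq_mul, ← Finset.sum_const]
          exact Finset.sum_congr rfl fun q hq => by rw [(Finset.mem_filter.1 hq).2]
      _ ≤ _ := by
          rw [← Finset.mul_sum]
          gcongr
          exact sum_overlapBound_le a (f p)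
  have hmu : muGamma γ ^ m =
      2 ^ (binEnt γ * m) * (2 ^ (γ * m) * (1 + 1 / Real.sqrt 2) ^ m / 2 ^ m) := by
    have h : 1 / 2 + 1 / (2 * Real.sqrt 2) = (1 + 1 / Real.sqrt 2) / 2 := by
      field_simp
    rw [muGamma, mul_pow, h, div_pow, ← Real.rpow_natCast, ← Real.rpow_mul (by norm_num), add_mul,
      Real.rpow_add (by norm_num)]
    ring
  simp only [← Fintype.sum_prod_type' (f := fun x y => ∑ a ∈ Finset.univ.filter
    (fun a : Bits m => (hw a : ℝ) ≤ γ * m), (star (routPsi n m eA eB ψ K L x y) ⬝ᵥ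
      (Nmat m (f (x, y)) a).mulVec (routPsi n m eA eB ψ K L x y)).re)]
  rw [Finset.sum_comm, Finset.mul_sum]
  calc _ ≤ ∑ _a ∈ Finset.univ.filter (fun a : Bits m => (hw a : ℝ) ≤ γ * m),
        2 ^ (γ * m) * (1 + 1 / Real.sqrt 2) ^ m / 2 ^ m := by
        refine Finset.sum_le_sum fun a ha => ?_
        have hwa : (2 : ℝ) ^ hw a ≤ 2 ^ (γ * m) := by
          rw [← Real.rpow_natCast]
          exact Real.rpow_le_rpow_of_exponent_le (by norm_num) (Finset.mem_filter.1 ha).2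
        calc _ ≤ (1 / 2 ^ (2 * n) : ℝ) *
              (2 ^ (2 * n) / 2 ^ m * (2 ^ hw a * (1 + 1 / Real.sqrt 2) ^ m)) :=
              mul_le_mul_of_nonneg_left (hbound a) (by positivity)
          _ = 2 ^ hw a * (1 + 1 / Real.sqrt 2) ^ m / 2 ^ m := by field_simp
          _ ≤ _ := by gcongr
    _ ≤ _ := by
        rw [Finset.sum_const, nsmul_eq_mul, hmu]
        gcongr
        exact card_hw_le hγ0 hγ1
end
end
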